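/- arXiv:1709.08136 — 2 statements merged into one kernel-verified Lean document; each statement's English description precedes it below -/
import Mathlib

section
/- Let X be a finite set with m elements, and let X = X₁₁ ⊔ X₁₂ and X = X₂₁ ⊔ X₂₂ be two bipartitions of X such that each of the four parts X₁₁, X₁₂, X₂₁, X₂₂ has size at least m/3. Then there exist two subsets Y₁ and Y₂ of X, each of size at least m/6, which lie on different sides of both bipartitions; that is, either (Y₁ ⊆ X₁₁ ∩ X₂₁ and Y₂ ⊆ X₁₂ ∩ X₂₂) or (Y₁ ⊆ X₁₁ ∩ X₂₂ and Y₂ ⊆ X₁₂ ∩ X₂₁). Moreover Y₁ and Y₂ can be chosen disjoint and of equal size. -/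
theorem Finset.exists_subset_card_eq_card_of_le {α : Type*} {P Q : Finset α} {r : ℝ}
    (hP : r ≤ P.card) (hQ : r ≤ Q.card) :
    ∃ Y₁ ⊆ P, ∃ Y₂ ⊆ Q, Y₁.card = Y₂.card ∧ r ≤ Y₁.card ∧ r ≤ Y₂.card := by
  obtain h | h := le_total P.card Q.card
  · obtain ⟨Y, hY, hc⟩ := Finset.exists_subset_card_eq h
    exact ⟨P, subset_rfl, Y, hY, hc.symm, hP, by rwa [hc]⟩
  · obtain ⟨Y, hY, hc⟩ := Finset.exists_subset_card_eq h
    exact ⟨Y, hY, Q, subset_rfl, hc, by rwa [hc], hQ⟩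

/-- **Lemma 1 (Spencer).** If `X` is an `m`-element set with two bipartitions
`X = X₁₁ ⊔ X₁₂` and `X = X₂₁ ⊔ X₂₂`, each part of size at least `m/3`, then there
exist disjoint subsets `Y₁, Y₂ ⊆ X` of equal size, each of size at least `m/6`,
lying on different sides of both bipartitions. -/
theorem spencer_two_bipartitions {α : Type*} [DecidableEq α]
    (X : Finset α) (m : ℕ) (hm : X.card = m)
    (X11 X12 X21 X22 : Finset α)
    (hdisj1 : Disjoint X11 X12) (hunion1 : X11 ∪ X12 = X)
    (hdisj2 : Disjoint X21 X22) (hunion2 : X21 ∪ X22 = X)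
    (h11 : (m : ℝ) / 3 ≤ X11.card) (h12 : (m : ℝ) / 3 ≤ X12.card)
    (h21 : (m : ℝ) / 3 ≤ X21.card) (h22 : (m : ℝ) / 3 ≤ X22.card) :
    ∃ Y₁ Y₂ : Finset α, Y₁ ⊆ X ∧ Y₂ ⊆ X ∧ Disjoint Y₁ Y₂ ∧ Y₁.card = Y₂.card ∧
      (m : ℝ) / 6 ≤ Y₁.card ∧ (m : ℝ) / 6 ≤ Y₂.card ∧
      ((Y₁ ⊆ X11 ∩ X21 ∧ Y₂ ⊆ X12 ∩ X22) ∨ (Y₁ ⊆ X11 ∩ X22 ∧ Y₂ ⊆ X12 ∩ X21)) := by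
  have card_split (A B C : Finset α) (hBC : Disjoint B C) (hA : A ⊆ B ∪ C) :
      (A.card : ℝ) = (A ∩ B).card + (A ∩ C).card := by
    rw [← Nat.cast_add, ← Finset.card_union_of_disjoint
      (hBC.mono Finset.inter_subset_right Finset.inter_subset_right),
      ← Finset.inter_union_distrib_left, Finset.inter_eq_left.mpr hA]
  have sub11 : X11 ⊆ X := hunion1 ▸ Finset.subset_union_left
  have sub12 : X12 ⊆ X := hunion1 ▸ Finset.subset_union_right
  have sub21 : X21 ⊆ X := hunion2 ▸ Finset.subset_union_left
  have sub22 : X22 ⊆ X := hunion2 ▸ Finset.subset_union_right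
  have card11 := card_split X11 X21 X22 hdisj2 (hunion2 ▸ sub11)
  have card12 := card_split X12 X21 X22 hdisj2 (hunion2 ▸ sub12)
  have card21 := card_split X21 X11 X12 hdisj1 (hunion1 ▸ sub21)
  have card22 := card_split X22 X11 X12 hdisj1 (hunion1 ▸ sub22)
  rw [Finset.inter_comm X21, Finset.inter_comm X21] at card21
  rw [Finset.inter_comm X22, Finset.inter_comm X22] at card22
  have large : ((m : ℝ) / 6 ≤ (X11 ∩ X21).card ∧ (m : ℝ) / 6 ≤ (X12 ∩ X22).card) ∨
      ((m : ℝ) / 6 ≤ (X11 ∩ X22).card ∧ (m : ℝ) / 6 ≤ (X12 ∩ X21).card) := by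
    by_cases ha : (m : ℝ) / 6 ≤ (X11 ∩ X21).card
    · by_cases hd : (m : ℝ) / 6 ≤ (X12 ∩ X22).card
      · exact .inl ⟨ha, hd⟩
      · exact .inr ⟨by linarith, by linarith⟩
    · exact .inr ⟨by linarith, by linarith⟩
  obtain ⟨hP, hQ⟩ | ⟨hP, hQ⟩ := large <;>
    obtain ⟨Y₁, hY₁, Y₂, hY₂, hcard, hr₁, hr₂⟩ :=
      Finset.exists_subset_card_eq_card_of_le hP hQ <;>
    have hY₁' := hY₁.trans Finset.inter_subset_left <;>
    have hY₂' := hY₂.trans Finset.inter_subset_left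
  · exact ⟨Y₁, Y₂, hY₁'.trans sub11, hY₂'.trans sub12, hdisj1.mono hY₁' hY₂',
      hcard, hr₁, hr₂, .inl ⟨hY₁, hY₂⟩⟩
  · exact ⟨Y₁, Y₂, hY₁'.trans sub11, hY₂'.trans sub12, hdisj1.mono hY₁' hY₂',
      hcard, hr₁, hr₂, .inr ⟨hY₁, hY₂⟩⟩
end

section
/- (Expander mixing lemma, Beigel–Margulis–Spielman variant.) Let G be a d-regular simple graph on n vertices such that every eigenvalue of its adjacency matrix except the largest one (the eigenvalue d, whose eigenvector is the all-ones vector) has absolute value at most μ; equivalently, ‖A v‖ ≤ μ‖v‖ for every vector v orthogonal to the all-ones vector, where A is the adjacency matrix. Let X and Y be disjoint vertex subsets of sizes |X| = αn and |Y| = βn. Then |e(X,Y) − αβdn| ≤ μ·n·√((α − α²)(β − β²)). -/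
open Finset

open Classical in
/-- `eBetween G X Y` is the number of edges of `G` with one endpoint in `X` and the
other in `Y`, for disjoint `X` and `Y`. -/
noncomputable def eBetween {V : Type*} (G : SimpleGraph V) (X Y : Finset V) : ℕ :=
  ((X ×ˢ Y).filter fun q => G.Adj q.1 q.2).card

/-- The squared norm of the indicator function of `X`, centred at its mean `α`. -/
theorem sum_sq_indicator_sub {V : Type*} [Fintype V] [DecidableEq V] (X : Finset V) {α : ℝ}
    (hX : (X.card : ℝ) = α * Fintype.card V) :
    ∑ i, ((if i ∈ X then (1 : ℝ) else 0) - α) ^ 2 = Fintype.card V * (α - α ^ 2) := by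
  have h (i : V) : ((if i ∈ X then (1 : ℝ) else 0) - α) ^ 2
      = (1 - 2 * α) * (if i ∈ X then (1 : ℝ) else 0) + α ^ 2 := by
    split_ifs <;> ring
  simp only [h, sum_add_distrib, ← mul_sum, sum_boole, filter_univ_mem, sum_const, card_univ,
    nsmul_eq_mul, hX]
  ring

theorem sum_indicator_sub {V : Type*} [Fintype V] [DecidableEq V] (X : Finset V) {α : ℝ}
    (hX : (X.card : ℝ) = α * Fintype.card V) :
    ∑ i, ((if i ∈ X then (1 : ℝ) else 0) - α) = 0 := by
  simp [hX, mul_comm]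

theorem eBetween_eq_sum {V : Type*} [Fintype V] [DecidableEq V]
    (G : SimpleGraph V) [DecidableRel G.Adj] (X Y : Finset V) :
    (eBetween G X Y : ℝ) = ∑ i ∈ Y, ∑ j ∈ X, G.adjMatrix ℝ i j := by
  rw [eBetween, card_filter, sum_product_right]
  push_cast
  refine sum_congr rfl fun i _ => sum_congr rfl fun j _ => ?_
  simp [SimpleGraph.adjMatrix_apply, G.adj_comm i j]

theorem adjMatrix_mulVec_indicator_sub {V : Type*} [Fintype V] [DecidableEq V]
    {G : SimpleGraph V} [DecidableRel G.Adj] {d : ℕ} (hreg : G.IsRegularOfDegree d)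
    (X : Finset V) (α : ℝ) (i : V) :
    (G.adjMatrix ℝ).mulVec (fun j => (if j ∈ X then (1 : ℝ) else 0) - α) i
      = ∑ j ∈ X, G.adjMatrix ℝ i j - d * α := by
  have hrow : ∑ j, G.adjMatrix ℝ i j = d := by
    simp [SimpleGraph.adjMatrix_apply, ← hreg i, ← SimpleGraph.card_neighborFinset_eq_degree,
      SimpleGraph.neighborFinset_eq_filter]
  simp only [Matrix.mulVec, dotProduct, mul_sub, sum_sub_distrib, ← sum_mul, hrow, mul_ite,
    mul_one, mul_zero, sum_ite_mem, univ_inter]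

/-- The bilinear form of the adjacency matrix on centred indicator functions measures the
discrepancy of the number of edges between two sets. -/
theorem sum_indicator_sub_mul_adjMatrix_mulVec {V : Type*} [Fintype V] [DecidableEq V]
    {G : SimpleGraph V} [DecidableRel G.Adj] {d : ℕ} (hreg : G.IsRegularOfDegree d)
    {X Y : Finset V} {α β : ℝ} (hX : (X.card : ℝ) = α * Fintype.card V)
    (hY : (Y.card : ℝ) = β * Fintype.card V) :
    ∑ i, ((if i ∈ Y then (1 : ℝ) else 0) - β) *
        (G.adjMatrix ℝ).mulVec (fun j => (if j ∈ X then (1 : ℝ) else 0) - α) i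
      = eBetween G X Y - α * β * d * Fintype.card V := by
  have hcol (j : V) : ∑ i, G.adjMatrix ℝ i j = d := by
    simp [SimpleGraph.adjMatrix_apply, ← hreg j, ← SimpleGraph.card_neighborFinset_eq_degree,
      SimpleGraph.neighborFinset_eq_filter, G.adj_comm j]
  have htotal : ∑ i, ∑ j ∈ X, G.adjMatrix ℝ i j = X.card * d :=
    sum_comm.trans (by simp only [hcol, sum_const, nsmul_eq_mul])
  simp only [adjMatrix_mulVec_indicator_sub hreg]
  simp only [mul_sub, sum_sub_distrib, ← sum_mul, sum_indicator_sub Y hY]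
  simp only [sub_mul, ite_mul, one_mul, zero_mul, sum_sub_distrib, ← mul_sum, sum_ite_mem,
    univ_inter, htotal, ← eBetween_eq_sum, hX]
  ring

/-- **Expander mixing lemma (Beigel–Margulis–Spielman variant).**
Let `G` be a `d`-regular graph on `n` vertices whose adjacency matrix `A` satisfies
`‖A v‖ ≤ μ ‖v‖` (Euclidean norms) for every vector `v` orthogonal to the all-ones
vector, i.e. every eigenvalue other than the largest has absolute value at most `μ`.
If `X, Y` are disjoint vertex sets with `|X| = αn` and `|Y| = βn`, then
`|e(X,Y) − αβdn| ≤ μ n √((α − α²)(β − β²))`. -/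
theorem expander_mixing_lemma {V : Type*} [Fintype V] [DecidableEq V]
    (G : SimpleGraph V) [DecidableRel G.Adj]
    (n d : ℕ) (hn : Fintype.card V = n) (hreg : G.IsRegularOfDegree d)
    (μ : ℝ)
    (hμ : ∀ v : V → ℝ, (∑ i, v i) = 0 →
      Real.sqrt (∑ i, ((G.adjMatrix ℝ).mulVec v i) ^ 2)
        ≤ μ * Real.sqrt (∑ i, (v i) ^ 2))
    (X Y : Finset V) (hXY : Disjoint X Y) (α β : ℝ)
    (hX : (X.card : ℝ) = α * n) (hY : (Y.card : ℝ) = β * n) :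
    |(eBetween G X Y : ℝ) - α * β * d * n|
      ≤ μ * n * Real.sqrt ((α - α ^ 2) * (β - β ^ 2)) := by
  subst hn
  set v : V → ℝ := fun i => (if i ∈ X then (1 : ℝ) else 0) - α
  set w : V → ℝ := fun i => (if i ∈ Y then (1 : ℝ) else 0) - β
  have hv : ∑ i, v i ^ 2 = Fintype.card V * (α - α ^ 2) := sum_sq_indicator_sub X hX
  have hw : ∑ i, w i ^ 2 = Fintype.card V * (β - β ^ 2) := sum_sq_indicator_sub Y hY
  have hnorm : √(∑ i, v i ^ 2) * √(∑ i, w i ^ 2)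
      = Fintype.card V * √((α - α ^ 2) * (β - β ^ 2)) := by
    rw [← Real.sqrt_mul (sum_nonneg fun i _ => sq_nonneg (v i)), hv, hw, mul_mul_mul_comm,
      Real.sqrt_mul (mul_self_nonneg _), Real.sqrt_mul_self (Nat.cast_nonneg _)]
  calc |(eBetween G X Y : ℝ) - α * β * d * Fintype.card V|
      = |∑ i, w i * (G.adjMatrix ℝ).mulVec v i| := by
        rw [sum_indicator_sub_mul_adjMatrix_mulVec hreg hX hY]
    _ ≤ √(∑ i, w i ^ 2) * √(∑ i, (G.adjMatrix ℝ).mulVec v i ^ 2) := by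
        rw [← Real.sqrt_mul (sum_nonneg fun i _ => sq_nonneg (w i))]
        exact Real.abs_le_sqrt (sum_mul_sq_le_sq_mul_sq _ _ _)
    _ ≤ √(∑ i, w i ^ 2) * (μ * √(∑ i, v i ^ 2)) := by
        gcongr
        exact hμ v (sum_indicator_sub X hX)
    _ = μ * Fintype.card V * √((α - α ^ 2) * (β - β ^ 2)) := by
        rw [mul_assoc μ, ← hnorm]
        ring
end
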